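/- There exist constants α₁ > α₂ > 0 and ε₀ > 0 such that for every ε ∈ (0, ε₀] there is a constant c₁ > 0 (depending on ε but not on n) with: for all n, P( n₊(X,Y) ≥ α₁·N₁(X,Y) and n₋(X,Y) ≤ α₂·N₁(X,Y) ) ≥ 1 − e^{−c₁ n}. (Equivalently, with probability at least 1 − e^{−c₁ n}, if one of the ones in the pair (X,Y) is picked uniformly at random and changed into a zero, the conditional probability that the LCS length increases by 1 is at least α₁ and the conditional probability that it decreases by 1 is at most α₂.) -/

import Mathlib

open scoped BigOperators
open Classical

noncomputable section

/-- Length of a longest common subsequence of two boolean lists. -/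
def lcsLen (x y : List Bool) : ℕ :=
  sSup {k : ℕ | ∃ z : List Bool, z.length = k ∧ z.Sublist x ∧ z.Sublist y}

/-- Bernoulli(ε) product weight of a binary string. -/
def wt (ε : ℝ) {n : ℕ} (x : Fin n → Bool) : ℝ :=
  ∏ i, if x i then ε else 1 - ε

/-- Probability of an event about two independent i.i.d. Bernoulli(ε) strings of length n. -/
def pr (ε : ℝ) (n : ℕ) (E : (Fin n → Bool) → (Fin n → Bool) → Prop) : ℝ :=
  ∑ x : Fin n → Bool, ∑ y : Fin n → Bool, if E x y then wt ε x * wt ε y else 0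

/-- LCS length of two binary strings of length n. -/
def Lcs {n : ℕ} (x y : Fin n → Bool) : ℕ := lcsLen (List.ofFn x) (List.ofFn y)

/-- Number of ones in a binary string. -/
def numOnes {n : ℕ} (x : Fin n → Bool) : ℕ :=
  (Finset.univ.filter fun i => x i = true).card

/-- Total number of ones in the pair (x, y). -/
def N1 {n : ℕ} (x y : Fin n → Bool) : ℕ := numOnes x + numOnes y

/-- Change the entry at position i into a zero. -/
def flipToZero {n : ℕ} (x : Fin n → Bool) (i : Fin n) : Fin n → Bool :=
  Function.update x i false

/-- Number of ones (in either string) whose change into a zero increases the LCS length by 1. -/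
def nPlus {n : ℕ} (x y : Fin n → Bool) : ℕ :=
  (Finset.univ.filter fun i => x i = true ∧ Lcs (flipToZero x i) y = Lcs x y + 1).card +
  (Finset.univ.filter fun i => y i = true ∧ Lcs x (flipToZero y i) = Lcs x y + 1).card

/-- Number of ones (in either string) whose change into a zero decreases the LCS length by 1. -/
def nMinus {n : ℕ} (x y : Fin n → Bool) : ℕ :=
  (Finset.univ.filter fun i => x i = true ∧ Lcs (flipToZero x i) y + 1 = Lcs x y).card +
  (Finset.univ.filter fun i => y i = true ∧ Lcs x (flipToZero y i) + 1 = Lcs x y).card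


/-! ### Combinatorics of longest common subsequences -/

abbrev zc (u : List Bool) : ℕ := u.count false
abbrev oc (u : List Bool) : ℕ := u.count true

lemma lcs_bdd (x y : List Bool) :
    BddAbove {k : ℕ | ∃ z : List Bool, z.length = k ∧ z.Sublist x ∧ z.Sublist y} := by
  refine ⟨x.length, ?_⟩
  rintro k ⟨z, rfl, h, -⟩
  exact h.length_le

lemma le_lcs {x y z : List Bool} (hx : z.Sublist x) (hy : z.Sublist y) :
    z.length ≤ lcsLen x y := le_csSup (lcs_bdd x y) ⟨z, rfl, hx, hy⟩

lemma exists_lcs (x y : List Bool) :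
    ∃ z : List Bool, z.length = lcsLen x y ∧ z.Sublist x ∧ z.Sublist y := by
  have := Nat.sSup_mem (s := {k : ℕ | ∃ z : List Bool, z.length = k ∧ z.Sublist x ∧ z.Sublist y})
    ⟨0, [], rfl, List.nil_sublist _, List.nil_sublist _⟩ (lcs_bdd x y)
  exact this

lemma lcs_min (u v : List Bool) : min (zc u) (zc v) ≤ lcsLen u v := by
  have h := @le_lcs u v (List.replicate (min (zc u) (zc v)) false)
    (List.replicate_sublist_iff.2 (min_le_left _ _))
    (List.replicate_sublist_iff.2 (min_le_right _ _))
  simpa using h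

lemma lcs_append (u v x y : List Bool) :
    lcsLen u v + lcsLen x y ≤ lcsLen (u ++ x) (v ++ y) := by
  obtain ⟨a, ha, h1, h2⟩ := exists_lcs u v
  obtain ⟨b, hb, h3, h4⟩ := exists_lcs x y
  have := le_lcs (h1.append h3) (h2.append h4)
  simp at this; omega

lemma lcs_cons (c : Bool) (x y : List Bool) :
    lcsLen x y + 1 ≤ lcsLen (c :: x) (c :: y) := by
  obtain ⟨b, hb, h3, h4⟩ := exists_lcs x y
  have := le_lcs (h3.cons_cons c) (h4.cons_cons c)
  simp at this; omega

lemma lcs_app1 (u v x y : List Bool) :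
    lcsLen u v + 1 + lcsLen x y ≤ lcsLen (u ++ true :: x) (v ++ true :: y) := by
  have := lcs_append u v (true :: x) (true :: y)
  have := lcs_cons true x y
  omega

lemma lcs_comm (x y : List Bool) : lcsLen x y = lcsLen y x := by
  unfold lcsLen
  congr 1; ext k; constructor <;> rintro ⟨z, a, b, c⟩ <;> exact ⟨z, a, c, b⟩

lemma lcs_mono {x x' y y' : List Bool} (h : x.Sublist x') (h' : y.Sublist y') :
    lcsLen x y ≤ lcsLen x' y' := by
  obtain ⟨a, ha, h1, h2⟩ := exists_lcs x y
  rw [← ha]; exact le_lcs (h1.trans h) (h2.trans h')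

lemma lcs_flip_le (p s y : List Bool) :
    lcsLen (p ++ false :: s) y ≤ lcsLen (p ++ true :: s) y + 1 := by
  obtain ⟨a, ha, h1, h2⟩ := exists_lcs (p ++ false :: s) y
  have key : a.length ≤ lcsLen (p ++ s) y + 1 := by
    obtain ⟨a1, a2, rfl, h3, h4⟩ := List.sublist_append_iff.1 h1
    rcases List.sublist_cons_iff.1 h4 with h5 | ⟨r, rfl, h5⟩
    · have := le_lcs (h3.append h5) h2
      omega
    · have := le_lcs (h3.append h5) (((List.Sublist.refl a1).append (List.sublist_cons_self false r)).trans h2)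
      simp at this ⊢; omega
  have := lcs_mono (show (p ++ s).Sublist (p ++ true :: s) from
    (List.Sublist.refl p).append (List.sublist_cons_self true s)) (List.Sublist.refl y)
  omega

/-- Number of ones of the string whose change into zero gives a string satisfying `P`. -/
def cnt : (List Bool → Prop) → List Bool → ℕ
  | _, [] => 0
  | P, b :: x => (if b = true ∧ P (false :: x) then 1 else 0) + cnt (fun w => P (b :: w)) x

lemma cnt_append (P : List Bool → Prop) (u w : List Bool) :
    cnt P (u ++ w) = cnt (fun u' => P (u' ++ w)) u + cnt (fun w' => P (u ++ w')) w := by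
  induction u generalizing P with
  | nil => simp [cnt]
  | cons b u ih => simp [cnt, ih, add_assoc]

lemma cnt_mono (P Q : List Bool → Prop) (x : List Bool)
    (h : ∀ p s, x = p ++ true :: s → P (p ++ false :: s) → Q (p ++ false :: s)) :
    cnt P x ≤ cnt Q x := by
  induction x generalizing P Q with
  | nil => simp [cnt]
  | cons b x ih =>
    simp only [cnt]
    have h1 := ih (fun w => P (b :: w)) (fun w => Q (b :: w)) (by
      intro p s hx hp
      exact h (b :: p) s (by simp [hx]) hp)
    have h2 : (if b = true ∧ P (false :: x) then 1 else 0)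
        ≤ (if b = true ∧ Q (false :: x) then 1 else 0) := by
      split_ifs with h3 h4 <;> simp
      apply h4
      refine ⟨h3.1, h [] x (by simp [h3.1]) h3.2⟩
    omega

lemma cnt_true (x : List Bool) : cnt (fun _ => True) x = oc x := by
  induction x with
  | nil => simp [cnt]
  | cons b x ih => cases b <;> simp [cnt, ih, add_comm]

lemma cnt_false (x : List Bool) : cnt (fun _ => False) x = 0 := by
  induction x with
  | nil => simp [cnt]
  | cons b x ih => simp [cnt, ih]

lemma cnt_le_oc (P : List Bool → Prop) (x : List Bool) : cnt P x ≤ oc x := by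
  rw [← cnt_true]; exact cnt_mono _ _ _ (fun _ _ _ _ => trivial)

lemma card_eq_cnt {n : ℕ} (x : Fin n → Bool) (P : List Bool → Prop) :
    (Finset.univ.filter fun i => x i = true ∧ P (List.ofFn (flipToZero x i))).card
      = cnt P (List.ofFn x) := by
  induction n generalizing P with
  | zero => simp [cnt]
  | succ n ih =>
    have e0 : List.ofFn (flipToZero x 0) = false :: List.ofFn (fun i => x (Fin.succ i)) := by
      simp [flipToZero, List.ofFn_succ]
    have e1 : ∀ i : Fin n, List.ofFn (flipToZero x i.succ)
        = x 0 :: List.ofFn (flipToZero (fun i => x (Fin.succ i)) i) := by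
      intro i
      rw [List.ofFn_succ]
      congr 1
      congr 1
      funext j
      simp [flipToZero, Function.update_apply]
    have e2 : List.ofFn x = x 0 :: List.ofFn (fun i => x (Fin.succ i)) := List.ofFn_succ
    rw [e2]
    simp only [cnt]
    rw [← ih, Fin.card_filter_univ_succ']
    simp only [e0, e1, Function.comp_def]

/-- Block decompositions. -/
inductive Dec : List Bool → List Bool → List (List Bool × List Bool) → Prop
  | last (u v) : Dec u v [(u, v)]
  | cons (u v x y l) : Dec x y l → Dec (u ++ true :: x) (v ++ true :: y) ((u, v) :: l)

def val (l : List (List Bool × List Bool)) : ℕ :=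
  (l.map fun p => min (zc p.1) (zc p.2)).sum + (l.length - 1)

lemma Dec.len_pos {x y l} (h : Dec x y l) : 1 ≤ l.length := by
  cases h <;> simp

lemma Dec.val_cons {x y l} (h : Dec x y l) (u v : List Bool) :
    val ((u, v) :: l) = min (zc u) (zc v) + 1 + val l := by
  have := h.len_pos
  simp [val]; omega

lemma Dec.val_le {x y l} (h : Dec x y l) : val l ≤ lcsLen x y := by
  induction h with
  | last u v => simpa [val] using lcs_min u v
  | cons u v x y l h ih =>
    rw [h.val_cons]
    have := lcs_app1 u v x y
    have := lcs_min u v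
    omega

lemma exists_dec_of_sub (w x y : List Bool) (hx : w.Sublist x) (hy : w.Sublist y) :
    ∃ l, Dec x y l ∧ w.length ≤ val l := by
  induction hn : w.length using Nat.strong_induction_on generalizing w x y with
  | _ n ih =>
  subst hn
  by_cases h : true ∈ w
  · obtain ⟨a, w', rfl, ha⟩ := List.eq_append_cons_of_mem h
    have haz : zc a = a.length := by
      rw [List.count_eq_length]
      intro b hb; cases b
      · rfl
      · exact absurd hb ha
    obtain ⟨u0, x0, rfl, h1, h2⟩ := List.append_sublist_iff.1 hx
    obtain ⟨v0, y0, rfl, h3, h4⟩ := List.append_sublist_iff.1 hy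
    obtain ⟨u1, x1, rfl, h5, h6⟩ := List.cons_sublist_iff.1 h2
    obtain ⟨v1, y1, rfl, h7, h8⟩ := List.cons_sublist_iff.1 h4
    obtain ⟨u2, u3, rfl⟩ := List.append_of_mem h5
    obtain ⟨v2, v3, rfl⟩ := List.append_of_mem h7
    obtain ⟨l, hl, hv⟩ := ih w'.length (by simp; omega) w' (u3 ++ x1) (v3 ++ y1)
      (h6.trans (List.sublist_append_right _ _)) (h8.trans (List.sublist_append_right _ _)) rfl
    refine ⟨(u0 ++ u2, v0 ++ v2) :: l, ?_, ?_⟩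
    · have := Dec.cons (u0 ++ u2) (v0 ++ v2) _ _ _ hl
      simpa using this
    · rw [hl.val_cons]
      have e1 := h1.count_le false
      have e2 := h3.count_le false
      simp only [zc] at haz
      simp [zc, List.count_append] 
      omega
  · refine ⟨[(x, y)], Dec.last x y, ?_⟩
    have haz : zc w = w.length := by
      rw [List.count_eq_length]
      intro b hb; cases b
      · rfl
      · exact absurd hb h
    have e1 := hx.count_le false
    have e2 := hy.count_le false
    simp only [zc] at haz
    simp [val, zc]; omega

lemma exists_dec (x y : List Bool) : ∃ l, Dec x y l ∧ val l = lcsLen x y := by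
  obtain ⟨z, hz, h1, h2⟩ := exists_lcs x y
  obtain ⟨l, hl, hv⟩ := exists_dec_of_sub z x y h1 h2
  exact ⟨l, hl, le_antisymm hl.val_le (by omega)⟩

/-- gain function of a block -/
def gn (u v : List Bool) : ℕ :=
  cnt (fun u' => min (zc u) (zc v) < lcsLen u' v) u +
  cnt (fun v' => min (zc u) (zc v) < lcsLen u v') v

lemma zc_flip (p s : List Bool) : zc (p ++ false :: s) = zc (p ++ true :: s) + 1 := by
  simp [zc, List.count_append]; omega

lemma Dec.gn_le {x y l} (h : Dec x y l) :
    (l.map fun p => gn p.1 p.2).sum ≤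
      cnt (fun x' => val l < lcsLen x' y) x + cnt (fun y' => val l < lcsLen x y') y := by
  induction h with
  | last u v => simp [gn, val]
  | cons u v x y l h ih =>
    rw [h.val_cons, cnt_append, cnt_append]
    simp only [cnt, List.map_cons, List.sum_cons]
    have hv := h.val_le
    have hm := lcs_min u v
    have a1 := cnt_mono (fun u' => min (zc u) (zc v) < lcsLen u' v)
      (fun u' => min (zc u) (zc v) + 1 + val l < lcsLen (u' ++ true :: x) (v ++ true :: y)) u (by
        intro p s _ hp
        have := lcs_app1 (p ++ false :: s) v x y
        omega)
    have a2 := cnt_mono (fun v' => min (zc u) (zc v) < lcsLen u v')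
      (fun v' => min (zc u) (zc v) + 1 + val l < lcsLen (u ++ true :: x) (v' ++ true :: y)) v (by
        intro p s _ hp
        have := lcs_app1 u (p ++ false :: s) x y
        omega)
    have a3 := cnt_mono (fun x' => val l < lcsLen x' y)
      (fun x' => min (zc u) (zc v) + 1 + val l < lcsLen (u ++ true :: x') (v ++ true :: y)) x (by
        intro p s _ hp
        have := lcs_app1 u v (p ++ false :: s) y
        omega)
    have a4 := cnt_mono (fun y' => val l < lcsLen x y')
      (fun y' => min (zc u) (zc v) + 1 + val l < lcsLen (u ++ true :: x) (v ++ true :: y')) y (by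
        intro p s _ hp
        have := lcs_app1 u v x (p ++ false :: s)
        omega)
    simp only [gn] at ih ⊢
    omega

lemma Dec.cntx_le {x y l} (h : Dec x y l) :
    cnt (fun x' => lcsLen x' y < val l) x ≤ l.length - 1 := by
  induction h with
  | last u v =>
    have := cnt_mono (fun x' => lcsLen x' v < val [(u, v)]) (fun _ => False) u (by
      intro p s hu hp
      have := lcs_min (p ++ false :: s) v
      rw [zc_flip, ← hu] at this
      simp [val] at hp
      omega)
    rw [cnt_false] at this
    simpa using this
  | cons u v x y l h ih =>
    rw [h.val_cons, cnt_append]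
    simp only [cnt]
    have hv := h.val_le
    have hm := lcs_min u v
    have hl := h.len_pos
    have a1 := cnt_mono (fun u' => lcsLen (u' ++ true :: x) (v ++ true :: y) < 
        min (zc u) (zc v) + 1 + val l) (fun _ => False) u (by
        intro p s hu hp
        have := lcs_app1 (p ++ false :: s) v x y
        have := lcs_min (p ++ false :: s) v
        rw [zc_flip, ← hu] at this
        omega)
    rw [cnt_false] at a1
    have a3 := cnt_mono 
      (fun x' => lcsLen (u ++ true :: x') (v ++ true :: y) < min (zc u) (zc v) + 1 + val l)
      (fun x' => lcsLen x' y < val l) x (by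
        intro p s _ hp
        have := lcs_app1 u v (p ++ false :: s) y
        omega)
    simp only [List.length_cons]
    split_ifs <;> omega

lemma Dec.swap {x y l} (h : Dec x y l) : Dec y x (l.map Prod.swap) := by
  induction h with
  | last u v => exact Dec.last v u
  | cons u v x y l h ih => exact Dec.cons v u y x _ ih

lemma val_swap (l : List (List Bool × List Bool)) : val (l.map Prod.swap) = val l := by
  simp [val, Function.comp_def, min_comm]

lemma Dec.cnty_le {x y l} (h : Dec x y l) :
    cnt (fun y' => lcsLen x y' < val l) y ≤ l.length - 1 := by
  have := h.swap.cntx_le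
  rw [val_swap] at this
  simpa [lcs_comm] using this

lemma Dec.zx {x y l} (h : Dec x y l) : (l.map fun p => zc p.1).sum = zc x := by
  induction h with
  | last u v => simp
  | cons u v x y l h ih => simp [ih, List.count_append]

lemma Dec.zy {x y l} (h : Dec x y l) : (l.map fun p => zc p.2).sum = zc y := by
  induction h with
  | last u v => simp
  | cons u v x y l h ih => simp [ih, List.count_append]

def df (u v : List Bool) : ℕ := (zc u - zc v) + (zc v - zc u)

lemma two_min_sum (l : List (List Bool × List Bool)) :
    2 * (l.map fun p => min (zc p.1) (zc p.2)).sum + (l.map fun p => df p.1 p.2).sum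
      = (l.map fun p => zc p.1).sum + (l.map fun p => zc p.2).sum := by
  induction l with
  | nil => simp
  | cons p l ih => simp only [List.map_cons, List.sum_cons, df] at ih ⊢; omega

lemma Dec.df_le {x y l} (h : Dec x y l) (ho : val l = lcsLen x y) :
    (l.map fun p => df p.1 p.2).sum ≤ 2 * (l.length - 1) + df x y := by
  have h1 := two_min_sum l
  rw [h.zx, h.zy] at h1
  have h2 := lcs_min x y
  rw [← ho] at h2
  simp only [val, df] at *
  omega

/-! ### gain of one block -/

lemma gn_lt {u v : List Bool} (h : zc u < zc v) : oc u ≤ gn u v := by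
  rw [← cnt_true]
  refine le_trans (cnt_mono _ (fun u' => min (zc u) (zc v) < lcsLen u' v) u ?_) (Nat.le_add_right _ _)
  intro p s hu _
  have := lcs_min (p ++ false :: s) v
  rw [zc_flip, ← hu] at this
  omega

lemma gn_gt {u v : List Bool} (h : zc v < zc u) : oc v ≤ gn u v := by
  rw [← cnt_true]
  refine le_trans (cnt_mono _ (fun v' => min (zc u) (zc v) < lcsLen u v') v ?_) (Nat.le_add_left _ _)
  intro p s hu _
  have := lcs_min u (p ++ false :: s)
  rw [zc_flip, ← hu] at this
  omega

lemma gn_coin1 {u1 u2 v1 v2 : List Bool} (h : zc (u1 ++ true :: u2) = zc (v1 ++ true :: v2))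
    (h1 : zc v1 ≤ zc u1) (h2 : zc u1 ≤ zc v1 + 1) :
    oc u2 ≤ gn (u1 ++ true :: u2) (v1 ++ true :: v2) := by
  rw [← cnt_true]
  have h' := h
  unfold gn
  rw [cnt_append]
  simp only [cnt]
  have := cnt_mono (fun _ => True) (fun w' => min (zc (u1 ++ true :: u2)) (zc (v1 ++ true :: v2)) <
    lcsLen (u1 ++ true :: w') (v1 ++ true :: v2)) u2 (by
      intro p s hu _
      have a1 := lcs_app1 u1 v1 (p ++ false :: s) v2
      have a2 := lcs_min (p ++ false :: s) v2
      have a3 := lcs_min u1 v1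
      rw [zc_flip, ← hu] at a2
      simp [zc, List.count_append] at h ⊢ a1 a2 a3 h1 h2
      omega)
  omega

lemma gn_comm (u v : List Bool) : gn u v = gn v u := by
  simp only [gn, min_comm (zc u) (zc v), lcs_comm]
  exact add_comm _ _

lemma gn_coin2 {u1 u2 v1 v2 : List Bool} (h : zc (u1 ++ true :: u2) = zc (v1 ++ true :: v2))
    (h1 : zc u1 ≤ zc v1) (h2 : zc v1 ≤ zc u1 + 1) :
    oc v2 ≤ gn (u1 ++ true :: u2) (v1 ++ true :: v2) := by
  rw [gn_comm]; exact gn_coin1 h.symm h1 h2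

lemma gn_app {a b u v : List Bool} (h : zc a = zc b) : gn u v ≤ gn (a ++ u) (b ++ v) := by
  unfold gn
  rw [cnt_append, cnt_append]
  have hm := lcs_min a b
  have a1 := cnt_mono (fun u' => min (zc u) (zc v) < lcsLen u' v)
    (fun u' => min (zc (a ++ u)) (zc (b ++ v)) < lcsLen (a ++ u') (b ++ v)) u (by
      intro p s _ hp
      have := lcs_append a b (p ++ false :: s) v
      simp only [zc, List.count_append] at *
      omega)
  have a2 := cnt_mono (fun v' => min (zc u) (zc v) < lcsLen u v')
    (fun v' => min (zc (a ++ u)) (zc (b ++ v)) < lcsLen (a ++ u) (b ++ v')) v (by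
      intro p s _ hp
      have := lcs_append a b u (p ++ false :: s)
      simp only [zc, List.count_append] at *
      omega)
  omega

/-! ### Weighted sums over all strings -/

open scoped ENNReal in
def W (a b : ℝ≥0∞) (u : List Bool) : ℝ≥0∞ := a ^ oc u * b ^ zc u

lemma W_append (a b : ENNReal) (u v : List Bool) : W a b (u ++ v) = W a b u * W a b v := by
  simp only [W, List.count_append, oc, zc, pow_add]; ring

lemma W_true (a b : ENNReal) (v : List Bool) : W a b (true :: v) = a * W a b v := by
  simp [W, pow_add]; ring

lemma W_false (a b : ENNReal) (v : List Bool) : W a b (false :: v) = b * W a b v := by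
  simp [W, pow_add]; ring

lemma tsp {α β : Type} (f : α × β → ENNReal) : ∑' p, f p = ∑' x, ∑' y, f (x, y) :=
  ENNReal.tsum_prod (f := fun x y => f (x, y))

/-- total weighted sum over pairs -/
def Ssum (a b : ENNReal) (f : List Bool → List Bool → ENNReal) : ENNReal :=
  ∑' p : List Bool × List Bool, W a b p.1 * W a b p.2 * f p.1 p.2

def TT (t : List Bool → List Bool → ENNReal) : ℕ → List Bool → List Bool → ENNReal
  | 0, _, _ => 0
  | N + 1, x, y => t x y + ∑' q : (List Bool × List Bool) × (List Bool × List Bool),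
      if (x, y) = (q.1.1 ++ true :: q.2.1, q.1.2 ++ true :: q.2.2) then
        t q.1.1 q.1.2 * TT t N q.2.1 q.2.2 else 0

lemma le_TT (t : List Bool → List Bool → ENNReal) {x y l} (h : Dec x y l) :
    (l.map fun p => t p.1 p.2).prod ≤ TT t l.length x y := by
  induction h with
  | last u v => simp [TT]
  | cons u v x y l h ih =>
    simp only [List.map_cons, List.prod_cons, List.length_cons, TT]
    refine le_trans ?_ le_add_self
    refine le_trans ?_ (ENNReal.le_tsum ((u, v), (x, y)))
    rw [if_pos rfl]
    gcongr

lemma Ssum_TT (a b : ENNReal) (t : List Bool → List Bool → ENNReal) (N : ℕ) :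
    Ssum a b (TT t (N + 1)) = Ssum a b t + a ^ 2 * Ssum a b t * Ssum a b (TT t N) := by
  unfold Ssum
  simp only [TT, mul_add]
  rw [ENNReal.tsum_add]
  congr 1
  simp only [← ENNReal.tsum_mul_left]
  rw [ENNReal.tsum_comm]
  have : ∀ q : (List Bool × List Bool) × (List Bool × List Bool),
      ∑' p : List Bool × List Bool, W a b p.1 * W a b p.2 *
        (if (p.1, p.2) = (q.1.1 ++ true :: q.2.1, q.1.2 ++ true :: q.2.2) then
        t q.1.1 q.1.2 * TT t N q.2.1 q.2.2 else 0)
      = a ^ 2 * (W a b q.1.1 * W a b q.1.2 * t q.1.1 q.1.2) *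
        (W a b q.2.1 * W a b q.2.2 * TT t N q.2.1 q.2.2) := by
    intro q
    rw [tsum_eq_single (q.1.1 ++ true :: q.2.1, q.1.2 ++ true :: q.2.2)]
    · rw [if_pos rfl]
      simp only [W_append, W_true]; ring
    · intro p hp
      rw [if_neg hp, mul_zero]
  rw [tsum_congr this, tsp]
  simp only [ENNReal.tsum_mul_left, ENNReal.tsum_mul_right]

lemma Ssum_TT_le (a b K : ENNReal) (t : List Bool → List Bool → ENNReal)
    (h : Ssum a b t + a ^ 2 * Ssum a b t * K ≤ K) (N : ℕ) : Ssum a b (TT t N) ≤ K := by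
  induction N with
  | zero => simp [Ssum, TT]
  | succ N ih =>
    rw [Ssum_TT]
    refine le_trans ?_ h
    gcongr

lemma TT_mono (t : List Bool → List Bool → ENNReal) (x y : List Bool) (N : ℕ) :
    TT t N x y ≤ TT t (N + 1) x y := by
  induction N generalizing x y with
  | zero => simp [TT]
  | succ N ih =>
    rw [TT, TT]
    gcongr with q
    split_ifs
    · gcongr; exact ih _ _
    · exact le_rfl

lemma TT_mono' (t : List Bool → List Bool → ENNReal) (x y : List Bool) {N M : ℕ} (h : N ≤ M) :
    TT t N x y ≤ TT t M x y :=
  monotone_nat_of_le_succ (f := fun N => TT t N x y) (TT_mono t x y) h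

/-- parse a string by its leading run of ones -/
lemma sum_parse (f : List Bool → ENNReal) :
    ∑' u, f u ≤ ∑' F : ℕ, f (List.replicate F true) +
      ∑' F : ℕ, ∑' u, f (List.replicate F true ++ false :: u) := by
  let e : ℕ ⊕ (ℕ × List Bool) → List Bool :=
    Sum.elim (fun F => List.replicate F true) (fun p => List.replicate p.1 true ++ false :: p.2)
  have he : Function.Surjective e := by
    intro u
    induction u with
    | nil => exact ⟨Sum.inl 0, rfl⟩
    | cons c u ih =>
      cases c
      · exact ⟨Sum.inr (0, u), rfl⟩
      · obtain ⟨s, hs⟩ := ih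
        rcases s with F | ⟨F, w⟩
        · exact ⟨Sum.inl (F + 1), by simpa [e, List.replicate_succ] using hs⟩
        · exact ⟨Sum.inr (F + 1, w), by simpa [e, List.replicate_succ] using hs⟩
  refine (ENNReal.tsum_le_tsum_comp_of_surjective he f).trans ?_
  rw [Summable.tsum_sum ENNReal.summable ENNReal.summable]
  gcongr
  · simp [e]
  · rw [tsp]
    simp [e]

/-- weighted sum over strings with exactly `k` zeros -/
def Zs (a b : ENNReal) (k : ℕ) (f : List Bool → ENNReal) : ENNReal :=
  ∑' u, if zc u = k then W a b u * f u else 0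

lemma Zs_zero (a b : ENNReal) (f : List Bool → ENNReal) :
    Zs a b 0 f ≤ ∑' F : ℕ, a ^ F * f (List.replicate F true) := by
  refine (sum_parse _).trans ?_
  simp [zc, W, oc, List.count_append, List.count_replicate]

lemma Zs_succ (a b : ENNReal) (k : ℕ) (f : List Bool → ENNReal) :
    Zs a b (k + 1) f ≤ ∑' F : ℕ, a ^ F * b * Zs a b k (fun u => f (List.replicate F true ++ false :: u)) := by
  refine (sum_parse _).trans ?_
  simp only [Zs, ← ENNReal.tsum_mul_left]
  have h1 : ∀ F : ℕ, zc (List.replicate F true) = 0 := by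
    intro F; simp [zc, List.count_replicate]
  have h2 : ∀ F : ℕ, oc (List.replicate F true) = F := by
    intro F; simp [oc]
  have : ∀ F : ℕ, ∀ u, zc (List.replicate F true ++ false :: u) = zc u + 1 := by
    intro F u
    simp [zc, List.count_append, List.count_replicate]
  simp only [h1, this]
  simp only [Nat.right_eq_add, Nat.add_eq_zero_iff, one_ne_zero, and_false, if_false, tsum_zero, zero_add,
    add_left_inj]
  simp
  gcongr with F u
  split_ifs
  · rw [W_append, W_false, W, h1, h2]; simp only [pow_zero, mul_one]
    rw [mul_assoc, mul_assoc, mul_assoc]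
  · simp

lemma Zs_mono (a b : ENNReal) (k : ℕ) {f g : List Bool → ENNReal} (h : ∀ u, zc u = k → f u ≤ g u) :
    Zs a b k f ≤ Zs a b k g := by
  unfold Zs
  gcongr with u
  split_ifs with h1
  · gcongr; exact h u h1
  · exact le_rfl

lemma Zs_mul (a b : ENNReal) (k : ℕ) (f : List Bool → ENNReal) (c : ENNReal) :
    Zs a b k (fun u => c * f u) = c * Zs a b k f := by
  unfold Zs
  rw [← ENNReal.tsum_mul_left]
  congr 1; ext u
  split_ifs
  · ring
  · simp

lemma Zs_add (a b : ENNReal) (k : ℕ) (f g : List Bool → ENNReal) :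
    Zs a b k (fun u => f u + g u) = Zs a b k f + Zs a b k g := by
  unfold Zs
  rw [← ENNReal.tsum_add]
  congr 1; ext u
  split_ifs
  · ring
  · simp

lemma Zs_tsum {ι : Type} (a b : ENNReal) (k : ℕ) (f : ι → List Bool → ENNReal) :
    Zs a b k (fun u => ∑' i, f i u) = ∑' i, Zs a b k (f i) := by
  unfold Zs
  rw [ENNReal.tsum_comm]
  congr 1; ext u
  split_ifs
  · rw [ENNReal.tsum_mul_left]
  · simp

/-- strings with `k` zeros weighted with `θ ^ ones`. -/
lemma Zs_theta (a b θ : ENNReal) (k : ℕ) :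
    Zs a b k (fun u => θ ^ oc u) ≤ (1 - a * θ)⁻¹ * (b * (1 - a * θ)⁻¹) ^ k := by
  induction k with
  | zero =>
    refine (Zs_zero _ _ _).trans ?_
    simp [oc, ← mul_pow, ENNReal.tsum_geometric]
  | succ k ih =>
    refine (Zs_succ _ _ _ _).trans ?_
    have : ∀ F : ℕ, a ^ F * b * Zs a b k (fun u => θ ^ oc (List.replicate F true ++ false :: u))
        = (a * θ) ^ F * (b * Zs a b k (fun u => θ ^ oc u)) := by
      intro F
      have : ∀ u, θ ^ oc (List.replicate F true ++ false :: u) = θ ^ F * θ ^ oc u := by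
        intro u; simp [oc, List.count_append, pow_add]
      simp only [this, Zs_mul]
      rw [mul_pow]; ring
    rw [tsum_congr this, ENNReal.tsum_mul_right, ENNReal.tsum_geometric]
    calc _ ≤ (1 - a * θ)⁻¹ * (b * ((1 - a * θ)⁻¹ * (b * (1 - a * θ)⁻¹) ^ k)) := by gcongr
      _ = _ := by rw [pow_succ]; ring

lemma Zs_one (a b : ENNReal) (hab : a + b = 1) (hb : b ≠ 0) (ha : a ≠ ⊤) (k : ℕ) :
    Zs a b k (fun _ => 1) ≤ b⁻¹ := by
  have h := Zs_theta a b 1 k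
  have h1 : 1 - a = b := by rw [← hab]; exact ENNReal.add_sub_cancel_left ha
  have hbt : b ≠ ⊤ := by
    rintro rfl; simp at hab
  simp only [one_pow, mul_one, h1, ENNReal.mul_inv_cancel hb hbt] at h
  exact h

/-- weighted sum over pairs with `k` zeros and `l` zeros. -/
def ZZ (a b : ENNReal) (k l : ℕ) (f : List Bool → List Bool → ENNReal) : ENNReal :=
  Zs a b k (fun u => Zs a b l (fun v => f u v))

lemma Ssum_eq (a b : ENNReal) (f : List Bool → List Bool → ENNReal) :
    Ssum a b f = ∑' k, ∑' l, ZZ a b k l f := by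
  have h : ∀ (f : List Bool → ENNReal), ∑' u, W a b u * f u = ∑' k, Zs a b k f := by
    intro f
    unfold Zs
    rw [ENNReal.tsum_comm]
    congr 1; ext u
    rw [tsum_eq_single (zc u)]
    · simp
    · intro k hk; rw [if_neg (Ne.symm hk)]
  unfold Ssum ZZ
  rw [tsp]
  simp only [mul_assoc, ENNReal.tsum_mul_left]
  simp only [h]
  congr 1; ext k
  rw [← Zs_tsum]

/-! ### The block sum -/

def pre (p : ℕ × ℕ) : List Bool :=
  List.replicate p.1 true ++ false :: (List.replicate p.2 true ++ [false])

def ew (a b : ENNReal) (p : ℕ × ℕ) : ENNReal := a ^ p.1 * b * (a ^ p.2 * b)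

lemma Zs_two (a b : ENNReal) (k : ℕ) (f : List Bool → ENNReal) :
    Zs a b (k + 2) f ≤ ∑' p : ℕ × ℕ, ew a b p * Zs a b k (fun u => f (pre p ++ u)) := by
  refine (Zs_succ a b (k + 1) f).trans ?_
  rw [tsp]
  refine ENNReal.tsum_le_tsum fun F => ?_
  simp only [ew, mul_assoc, ENNReal.tsum_mul_left]
  gcongr
  refine (Zs_succ a b k _).trans ?_
  simp [pre, mul_assoc]

lemma ew_tot (a b : ENNReal) (hab : a + b = 1) (hb : b ≠ 0) (ha : a ≠ ⊤) :
    ∑' p, ew a b p = 1 := by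
  have h1 : 1 - a = b := by rw [← hab]; exact ENNReal.add_sub_cancel_left ha
  have hbt : b ≠ ⊤ := by
    rintro rfl; simp at hab
  rw [tsp]
  simp only [ew]
  simp only [ENNReal.tsum_mul_left, ENNReal.tsum_mul_right, ENNReal.tsum_geometric, h1,
    ENNReal.inv_mul_cancel hb hbt, mul_one]

lemma ew_split (a b s A B : ENNReal) (hab : a + b = 1) (hb : b ≠ 0) (ha : a ≠ ⊤)
    (hs : b ^ 2 + s = 1) :
    ∑' p : ℕ × ℕ, ew a b p * (if p = 0 then A else B) = b ^ 2 * A + s * B := by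
  have hbt : b ≠ ⊤ := by
    rintro rfl; simp at hab
  have h0 : ew a b 0 = b ^ 2 := by simp [ew]; ring
  have h := ew_tot a b hab hb ha
  rw [ENNReal.tsum_eq_add_tsum_ite 0, h0] at h
  have hs' : (∑' p : ℕ × ℕ, if p = 0 then 0 else ew a b p) = s := by
    rw [← hs] at h
    convert (ENNReal.add_right_inj (ENNReal.pow_ne_top hbt)).1 h
  rw [ENNReal.tsum_eq_add_tsum_ite 0, h0, if_pos rfl, ← hs', ← ENNReal.tsum_mul_right]
  congr 1
  congr 1; ext p
  split_ifs <;> simp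

lemma zc_pre (p : ℕ × ℕ) : zc (pre p) = 2 := by
  simp [pre, zc, List.count_append, List.count_replicate]

lemma pre_split (p : ℕ × ℕ) (hp : p ≠ 0) : ∃ w w', pre p = w ++ true :: w' ∧ zc w ≤ 1 := by
  obtain ⟨F, F'⟩ := p
  rcases F with _ | F
  · rcases F' with _ | F'
    · exact absurd rfl hp
    · exact ⟨[false], List.replicate F' true ++ [false], by simp [pre, List.replicate_succ], by simp⟩
  · exact ⟨[], List.replicate F true ++ false :: (List.replicate F' true ++ [false]),
      by simp [pre, List.replicate_succ], by simp⟩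

lemma gn_pre (p p' : ℕ × ℕ) (hp : p ≠ 0) (hp' : p' ≠ 0) (u v : List Bool) (h : zc u = zc v) :
    oc u ≤ gn (pre p ++ u) (pre p' ++ v) ∨ oc v ≤ gn (pre p ++ u) (pre p' ++ v) := by
  obtain ⟨w, w', e, h1⟩ := pre_split p hp
  obtain ⟨z, z', e', h1'⟩ := pre_split p' hp'
  have hz : zc (w ++ true :: (w' ++ u)) = zc (z ++ true :: (z' ++ v)) := by
    have a1 := zc_pre p
    have a2 := zc_pre p'
    rw [e] at a1; rw [e'] at a2
    simp only [zc, List.count_append, List.count_cons] at *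
    omega
  rw [e, e']
  simp only [List.append_assoc, List.cons_append]
  rcases le_total (zc z) (zc w) with hc | hc
  · left
    refine le_trans ?_ (gn_coin1 hz hc (by omega))
    simp [oc, List.count_append]
  · right
    refine le_trans ?_ (gn_coin2 hz hc (by omega))
    simp [oc, List.count_append]

lemma ZZ_mono (a b : ENNReal) (k l : ℕ) {f g : List Bool → List Bool → ENNReal}
    (h : ∀ u v, zc u = k → zc v = l → f u v ≤ g u v) :
    ZZ a b k l f ≤ ZZ a b k l g :=
  Zs_mono _ _ _ fun u hu => Zs_mono _ _ _ fun v hv => h u v hu hv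

lemma ZZ_prod (a b c : ENNReal) (k l : ℕ) (f g : List Bool → ENNReal) :
    ZZ a b k l (fun u v => c * f u * g v) = c * Zs a b k f * Zs a b l g := by
  unfold ZZ
  simp only [Zs_mul]
  have : ∀ u, c * f u * Zs a b l (fun v => g v) = (c * Zs a b l g) * f u := by intro u; ring
  simp only [this, Zs_mul]
  ring

lemma ZZ_mul (a b c : ENNReal) (k l : ℕ) (f : List Bool → List Bool → ENNReal) :
    ZZ a b k l (fun u v => c * f u v) = c * ZZ a b k l f := by
  unfold ZZ
  simp only [Zs_mul]

def AB (a b θ : ENNReal) (k : ℕ) : ENNReal := (1 - a * θ)⁻¹ * (b * (1 - a * θ)⁻¹) ^ k * b⁻¹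

def HH (a b θ : ENNReal) (k : ℕ) : ENNReal := ZZ a b k k (fun u v => θ ^ gn u v)

lemma ZZ_left (a b θ : ENNReal) (hab : a + b = 1) (hb : b ≠ 0) (ha : a ≠ ⊤) (k l : ℕ) :
    ZZ a b k l (fun u _ => θ ^ oc u) ≤ AB a b θ k := by
  have := ZZ_prod a b 1 k l (fun u => θ ^ oc u) (fun _ => 1)
  simp only [one_mul, mul_one] at this
  rw [this]
  exact mul_le_mul' (Zs_theta a b θ k) (Zs_one a b hab hb ha l)

lemma ZZ_right (a b θ : ENNReal) (hab : a + b = 1) (hb : b ≠ 0) (ha : a ≠ ⊤) (k l : ℕ) :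
    ZZ a b k l (fun _ v => θ ^ oc v) ≤ AB a b θ l := by
  have := ZZ_prod a b 1 k l (fun _ => 1) (fun u => θ ^ oc u)
  simp only [one_mul] at this
  rw [this, mul_comm]
  exact mul_le_mul' (Zs_theta a b θ l) (Zs_one a b hab hb ha k)

lemma HH_le (a b θ : ENNReal) (hθ : θ ≤ 1) (hab : a + b = 1) (hb : b ≠ 0) (ha : a ≠ ⊤) (k : ℕ) :
    HH a b θ k ≤ b⁻¹ * b⁻¹ := by
  have := ZZ_prod a b 1 k k (fun _ => 1) (fun _ => 1)
  simp only [one_mul] at this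
  refine le_trans ?_ (mul_le_mul' (Zs_one a b hab hb ha k) (Zs_one a b hab hb ha k))
  rw [← this]
  exact ZZ_mono _ _ _ _ fun u v _ _ => pow_le_one' hθ _

lemma ZZ_add (a b : ENNReal) (k l : ℕ) (f g : List Bool → List Bool → ENNReal) :
    ZZ a b k l (fun u v => f u v + g u v) = ZZ a b k l f + ZZ a b k l g := by
  unfold ZZ
  simp only [Zs_add]

lemma HH_step (a b θ s : ENNReal) (hθ : θ ≤ 1) (hab : a + b = 1) (hb : b ≠ 0) (ha : a ≠ ⊤)
    (hs : b ^ 2 + s = 1) (k : ℕ) :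
    HH a b θ (k + 2) ≤ (b ^ 2 + s * b ^ 2) * HH a b θ k + 2 * s ^ 2 * AB a b θ k := by
  have h1 : HH a b θ (k + 2) ≤ ∑' p : ℕ × ℕ, ew a b p * ∑' p' : ℕ × ℕ, ew a b p' *
      ZZ a b k k (fun u v => θ ^ gn (pre p ++ u) (pre p' ++ v)) := by
    refine (Zs_two a b k _).trans ?_
    gcongr with p
    refine (Zs_mono a b k (fun u _ => Zs_two a b k _)).trans ?_
    rw [Zs_tsum]
    gcongr with p'
    rw [Zs_mul]
    exact le_rfl
  have h2 : ∀ p p' : ℕ × ℕ, ZZ a b k k (fun u v => θ ^ gn (pre p ++ u) (pre p' ++ v)) ≤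
      if p = 0 then HH a b θ k else if p' = 0 then HH a b θ k else 2 * AB a b θ k := by
    intro p p'
    have h3 : ZZ a b k k (fun u v => θ ^ gn (pre p ++ u) (pre p' ++ v)) ≤ HH a b θ k := by
      refine ZZ_mono _ _ _ _ fun u v _ _ => ?_
      exact pow_le_pow_right_of_le_one' hθ (gn_app (by rw [zc_pre, zc_pre]))
    split_ifs with hp hp'
    · exact h3
    · exact h3
    · have : 2 * AB a b θ k = AB a b θ k + AB a b θ k := two_mul _
      rw [this]
      refine le_trans ?_ (add_le_add (ZZ_left a b θ hab hb ha k k) (ZZ_right a b θ hab hb ha k k))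
      rw [← ZZ_add]
      refine ZZ_mono _ _ _ _ fun u v hu hv => ?_
      rcases gn_pre p p' hp hp' u v (by rw [hu, hv]) with h | h
      · exact (pow_le_pow_right_of_le_one' hθ h).trans le_self_add
      · exact (pow_le_pow_right_of_le_one' hθ h).trans le_add_self
  refine h1.trans ?_
  calc _ ≤ ∑' p : ℕ × ℕ, ew a b p * (if p = 0 then HH a b θ k else
        (b ^ 2 * HH a b θ k + s * (2 * AB a b θ k))) := by
        gcongr with p
        refine (ENNReal.tsum_le_tsum fun p' => mul_le_mul' le_rfl (h2 p p')).trans ?_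
        split_ifs with hp
        · rw [ENNReal.tsum_mul_right, ew_tot a b hab hb ha, one_mul]
        · rw [ew_split a b s _ _ hab hb ha hs]
    _ = b ^ 2 * HH a b θ k + s * (b ^ 2 * HH a b θ k + s * (2 * AB a b θ k)) :=
        ew_split a b s _ _ hab hb ha hs
    _ = _ := by ring

lemma AB_sum (a b θ β : ENNReal) :
    ∑' k, β ^ k * AB a b θ k =
      (1 - a * θ)⁻¹ * b⁻¹ * (1 - β * (b * (1 - a * θ)⁻¹))⁻¹ := by
  rw [← ENNReal.tsum_geometric (β * (b * (1 - a * θ)⁻¹)), ← ENNReal.tsum_mul_left]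
  refine tsum_congr fun k => ?_
  rw [AB, mul_pow β]; ring

lemma HH_sum (a b θ s β K : ENNReal) (hθ : θ ≤ 1) (hab : a + b = 1) (hb : b ≠ 0) (ha : a ≠ ⊤)
    (hs : b ^ 2 + s = 1)
    (hK : (1 + β) * (b⁻¹ * b⁻¹) + 2 * s ^ 2 * β ^ 2 * (∑' k, β ^ k * AB a b θ k)
      + β ^ 2 * (b ^ 2 + s * b ^ 2) * K ≤ K) :
    ∑' k, β ^ k * HH a b θ k ≤ K := by
  rw [ENNReal.tsum_eq_iSup_nat]
  refine iSup_le fun N => ?_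
  have main : ∀ N : ℕ, ∑ k ∈ Finset.range (N + 2), β ^ k * HH a b θ k ≤
      (1 + β) * (b⁻¹ * b⁻¹) + 2 * s ^ 2 * β ^ 2 * (∑' k, β ^ k * AB a b θ k)
      + β ^ 2 * (b ^ 2 + s * b ^ 2) * (∑ k ∈ Finset.range N, β ^ k * HH a b θ k) := by
    intro N
    rw [Finset.sum_range_succ', Finset.sum_range_succ']
    have e1 : ∑ k ∈ Finset.range N, β ^ (k + 1 + 1) * HH a b θ (k + 1 + 1) ≤
        2 * s ^ 2 * β ^ 2 * (∑' k, β ^ k * AB a b θ k)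
      + β ^ 2 * (b ^ 2 + s * b ^ 2) * (∑ k ∈ Finset.range N, β ^ k * HH a b θ k) := by
      calc _ ≤ ∑ k ∈ Finset.range N, (2 * s ^ 2 * β ^ 2 * (β ^ k * AB a b θ k) +
            β ^ 2 * (b ^ 2 + s * b ^ 2) * (β ^ k * HH a b θ k)) := by
            refine Finset.sum_le_sum fun k _ => ?_
            refine (mul_le_mul' le_rfl (HH_step a b θ s hθ hab hb ha hs k)).trans (le_of_eq ?_)
            ring
        _ ≤ _ := by
            rw [Finset.sum_add_distrib, ← Finset.mul_sum, ← Finset.mul_sum]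
            gcongr
            exact ENNReal.sum_le_tsum _
    have e2 := HH_le a b θ hθ hab hb ha 0
    have e3 := HH_le a b θ hθ hab hb ha 1
    calc _ ≤ 2 * s ^ 2 * β ^ 2 * (∑' k, β ^ k * AB a b θ k)
      + β ^ 2 * (b ^ 2 + s * b ^ 2) * (∑ k ∈ Finset.range N, β ^ k * HH a b θ k)
        + β ^ (0 + 1) * (b⁻¹ * b⁻¹) + β ^ 0 * (b⁻¹ * b⁻¹) := by
          gcongr
      _ = _ := by ring
  have key : ∀ N, ∑ k ∈ Finset.range N, β ^ k * HH a b θ k ≤ K ∧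
      ∑ k ∈ Finset.range (N + 1), β ^ k * HH a b θ k ≤ K := by
    intro N
    induction N with
    | zero =>
      refine ⟨by simp, ?_⟩
      refine le_trans ?_ ((main 0).trans (le_trans ?_ hK))
      · exact Finset.sum_le_sum_of_subset (Finset.range_mono (by omega))
      · gcongr; simp
    | succ N ih =>
      refine ⟨ih.2, (main N).trans (le_trans ?_ hK)⟩
      gcongr
      exact ih.1
  exact (key N).1

lemma tsum_shift (k : ℕ) (f : ℕ → ENNReal) :
    ∑' l, (if k < l then f (l - k) else 0) ≤ ∑' j, f j := by
  have h : Function.Injective (fun j : ℕ => j + k) := add_left_injective k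
  rw [← h.tsum_eq]
  · gcongr with j
    split_ifs
    · simp
    · simp
  · intro l hl
    by_cases hk : k < l
    · exact ⟨l - k, by simp; omega⟩
    · simp [hk] at hl

/-- block tilt -/
def tl (c r β θ : ENNReal) (u v : List Bool) : ENNReal :=
  c * r ^ df u v * β ^ zc u * θ ^ gn u v

lemma tl_sum (a b c r β θ : ENNReal) (hθ : θ ≤ 1) (hab : a + b = 1) (hb : b ≠ 0) (ha : a ≠ ⊤) :
    Ssum a b (tl c r β θ) ≤ c * (∑' k, β ^ k * HH a b θ k +
      (∑' k, β ^ k * AB a b θ k) * ((1 - r)⁻¹ + (1 - r * β)⁻¹)) := by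
  have h : ∀ k l, ZZ a b k l (tl c r β θ) ≤ c * ((if l = k then β ^ k * HH a b θ k else 0) +
      ((if k < l then r ^ (l - k) else 0) * (β ^ k * AB a b θ k) +
       (if l < k then (r * β) ^ (k - l) else 0) * (β ^ l * AB a b θ l))) := by
    intro k l
    rcases lt_trichotomy k l with hkl | hkl | hkl
    · rw [if_neg (by omega), if_pos hkl, if_neg (by omega)]
      calc _ ≤ ZZ a b k l (fun u v => (c * r ^ (l - k) * β ^ k) * θ ^ oc u) := by
            refine ZZ_mono _ _ _ _ fun u v hu hv => ?_
            have hd : df u v = l - k := by simp only [df, hu, hv]; omega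
            rw [tl, hd, hu]
            gcongr 1
            exact pow_le_pow_right_of_le_one' hθ (gn_lt (by omega))
        _ ≤ (c * r ^ (l - k) * β ^ k) * AB a b θ k := by
            rw [ZZ_mul]; gcongr; exact ZZ_left a b θ hab hb ha k l
        _ = _ := by ring
    · subst hkl
      simp only [if_true, lt_irrefl, if_false, zero_mul, add_zero]
      calc _ ≤ ZZ a b k k (fun u v => (c * β ^ k) * θ ^ gn u v) := by
            refine ZZ_mono _ _ _ _ fun u v hu hv => ?_
            have hd : df u v = 0 := by simp only [df, hu, hv]; omega
            rw [tl, hd, hu]; simp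
        _ = _ := by rw [ZZ_mul, HH]; ring
    · rw [if_neg (by omega), if_neg (by omega), if_pos hkl]
      calc _ ≤ ZZ a b k l (fun u v => (c * r ^ (k - l) * β ^ k) * θ ^ oc v) := by
            refine ZZ_mono _ _ _ _ fun u v hu hv => ?_
            have hd : df u v = k - l := by simp only [df, hu, hv]; omega
            rw [tl, hd, hu]
            gcongr 1
            exact pow_le_pow_right_of_le_one' hθ (gn_gt (by omega))
        _ ≤ (c * r ^ (k - l) * β ^ k) * AB a b θ l := by
            rw [ZZ_mul]; gcongr; exact ZZ_right a b θ hab hb ha k l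
        _ = _ := by
            have : β ^ k = β ^ (k - l) * β ^ l := by rw [← pow_add]; congr 1; omega
            rw [this, mul_pow]; ring
  rw [Ssum_eq]
  refine (ENNReal.tsum_le_tsum fun k => ENNReal.tsum_le_tsum fun l => h k l).trans ?_
  simp only [ENNReal.tsum_mul_left, ENNReal.tsum_add]
  gcongr c * (?_ + ?_)
  · gcongr with k
    simp
  · rw [mul_add]
    gcongr ?_ + ?_
    · rw [← ENNReal.tsum_mul_right]
      gcongr with k
      rw [ENNReal.tsum_mul_right, mul_comm, ← ENNReal.tsum_geometric]
      refine mul_le_mul' le_rfl ?_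
      exact tsum_shift k (fun j => r ^ j)
    · rw [ENNReal.tsum_comm, ← ENNReal.tsum_mul_right]
      gcongr with l
      rw [ENNReal.tsum_mul_right, mul_comm, ← ENNReal.tsum_geometric]
      refine mul_le_mul' le_rfl ?_
      exact tsum_shift l (fun j => (r * β) ^ j)

/-! ### Numerics -/

section numerics
open ENNReal

lemma one_sub_ofReal {x : ℝ} (hx : 0 ≤ x) : (1 : ENNReal) - ENNReal.ofReal x = ENNReal.ofReal (1 - x) := by
  rw [ENNReal.ofReal_sub _ hx, ENNReal.ofReal_one]

lemma AB_num (ε : ℝ) (h0 : 0 < ε) (h1 : ε ≤ 1 / 10 ^ 13) :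
    ∑' k, (ENNReal.ofReal (1 + ε ^ 2 / 4)) ^ k *
      AB (ENNReal.ofReal ε) (ENNReal.ofReal (1 - ε)) (ENNReal.ofReal (1 - 10000 * ε)) k
      ≤ ENNReal.ofReal (1 / (9000 * ε ^ 2)) := by
  rw [AB_sum]
  have p1 : 0 < 1 - ε := by linarith
  have p2 : 0 ≤ 1 - 10000 * ε := by linarith
  have p3 : 0 < 1 - ε * (1 - 10000 * ε) := by nlinarith
  have p4 : 0 < ε ^ 2 := by positivity
  have p5 : 0 < 1 - (1 + ε ^ 2 / 4) * ((1 - ε) * (1 - ε * (1 - 10000 * ε))⁻¹) := by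
    rw [sub_pos, ← mul_assoc, ← div_eq_mul_inv, div_lt_one p3]
    nlinarith
  rw [← ENNReal.ofReal_mul h0.le, one_sub_ofReal (by positivity), ← ENNReal.ofReal_inv_of_pos p3,
    ← ENNReal.ofReal_inv_of_pos p1, ← ENNReal.ofReal_mul p1.le, ← ENNReal.ofReal_mul (by positivity),
    ← ENNReal.ofReal_mul (by positivity),
    one_sub_ofReal (by positivity), ← ENNReal.ofReal_inv_of_pos p5, ← ENNReal.ofReal_mul (by positivity)]
  apply ENNReal.ofReal_le_ofReal
  rw [← mul_inv, ← mul_inv, ← one_div]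
  apply one_div_le_one_div_of_le (by positivity)
  have : (1 - ε * (1 - 10000 * ε)) * (1 - ε) *
      (1 - (1 + ε ^ 2 / 4) * ((1 - ε) * (1 - ε * (1 - 10000 * ε))⁻¹))
      = (1 - ε) * (10000 * ε ^ 2 - ε ^ 2 / 4 * (1 - ε)) := by
    have hp := mul_inv_cancel₀ p3.ne'
    linear_combination (-((1 - ε) * (1 + ε ^ 2 / 4) * (1 - ε))) * hp
  rw [this]
  have : 9999 * ε ^ 2 ≤ 10000 * ε ^ 2 - ε ^ 2 / 4 * (1 - ε) := by nlinarith
  nlinarith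

lemma HH_num (ε : ℝ) (h0 : 0 < ε) (h1 : ε ≤ 1 / 10 ^ 13) :
    ∑' k, (ENNReal.ofReal (1 + ε ^ 2 / 4)) ^ k *
      HH (ENNReal.ofReal ε) (ENNReal.ofReal (1 - ε)) (ENNReal.ofReal (1 - 10000 * ε)) k
      ≤ ENNReal.ofReal (7 / (10 * ε ^ 2)) := by
  have p1 : 0 < 1 - ε := by linarith
  have p4 : 0 < ε ^ 2 := by positivity
  have p6 : 0 ≤ 2 * ε - ε ^ 2 := by nlinarith
  refine HH_sum _ _ _ (ENNReal.ofReal (2 * ε - ε ^ 2)) _ _ ?_ ?_ ?_ ?_ ?_ ?_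
  · rw [ENNReal.ofReal_le_one]; linarith
  · rw [← ENNReal.ofReal_add h0.le p1.le]; simp
  · simpa using p1
  · simp
  · rw [← ENNReal.ofReal_pow p1.le, ← ENNReal.ofReal_add (by positivity) p6]
    ring_nf; simp
  · refine (add_le_add (add_le_add le_rfl (mul_le_mul' le_rfl (AB_num ε h0 h1))) le_rfl).trans ?_
    have two : (2 : ENNReal) = ENNReal.ofReal 2 := by simp
    have one : (1 : ENNReal) = ENNReal.ofReal 1 := by simp
    rw [two, one, ← ENNReal.ofReal_inv_of_pos p1, ← ENNReal.ofReal_pow p1.le, 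
      ← ENNReal.ofReal_pow p6, ← ENNReal.ofReal_pow (by positivity), ← ENNReal.ofReal_add (by positivity) (by positivity),
      ← ENNReal.ofReal_mul (by positivity), ← ENNReal.ofReal_mul (by positivity),
      ← ENNReal.ofReal_mul (by positivity), ← ENNReal.ofReal_mul (by positivity),
      ← ENNReal.ofReal_mul (by positivity), ← ENNReal.ofReal_mul (by positivity),
      ← ENNReal.ofReal_add (by positivity) (by positivity),
      ← ENNReal.ofReal_add (by positivity) (by positivity),
      ← ENNReal.ofReal_mul (by positivity), 
      ← ENNReal.ofReal_mul (by positivity),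
      ← ENNReal.ofReal_add (by positivity) (by positivity)]
    apply ENNReal.ofReal_le_ofReal
    have e2 : ε ^ 2 ≤ 1 / 10 ^ 13 := by nlinarith
    have q1 : (1 - ε)⁻¹ * (1 - ε)⁻¹ ≤ 1.001 := by
      rw [← mul_inv, inv_le_comm₀ (by positivity) (by norm_num)]
      norm_num
      nlinarith
    have q2 : (1 + (1 + ε ^ 2 / 4)) * ((1 - ε)⁻¹ * (1 - ε)⁻¹) ≤ 2.01 := by
      have : 1 + (1 + ε ^ 2 / 4) ≤ 2.001 := by linarith
      calc (1 + (1 + ε ^ 2 / 4)) * ((1 - ε)⁻¹ * (1 - ε)⁻¹) ≤ (2.001 : ℝ) * 1.001 := by gcongr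
        _ ≤ 2.01 := by norm_num
    have q3 : 2 * (2 * ε - ε ^ 2) ^ 2 * (1 + ε ^ 2 / 4) ^ 2 * (1 / (9000 * ε ^ 2)) ≤ 0.01 := by
      have : (2 * ε - ε ^ 2) ^ 2 ≤ 4 * ε ^ 2 := by nlinarith
      have h3 : (1 + ε ^ 2 / 4) ^ 2 ≤ 2 := by nlinarith
      calc _ ≤ 2 * (4 * ε ^ 2) * 2 * (1 / (9000 * ε ^ 2)) := by gcongr
        _ = 16 / 9000 := by field_simp; norm_num
        _ ≤ _ := by norm_num
    have q4 : (1 + ε ^ 2 / 4) ^ 2 * ((1 - ε) ^ 2 + (2 * ε - ε ^ 2) * (1 - ε) ^ 2) ≤ 1 - 3 * ε ^ 2 := by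
      have e3 : (1 - ε) ^ 2 + (2 * ε - ε ^ 2) * (1 - ε) ^ 2 = 1 - (2 * ε - ε ^ 2) ^ 2 := by ring
      have e4 : 3.9 * ε ^ 2 ≤ (2 * ε - ε ^ 2) ^ 2 := by
        have : (2 * ε - ε ^ 2) ^ 2 = ε ^ 2 * (2 - ε) ^ 2 := by ring
        rw [this, mul_comm]
        gcongr
        norm_num; nlinarith
      have e5 : (1 + ε ^ 2 / 4) ^ 2 ≤ 1 + 0.6 * ε ^ 2 := by nlinarith
      rw [e3]
      calc _ ≤ (1 + 0.6 * ε ^ 2) * (1 - 3.9 * ε ^ 2) := by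
            gcongr
            · nlinarith
        _ ≤ _ := by nlinarith
    have q5 : (1 + ε ^ 2 / 4) ^ 2 * ((1 - ε) ^ 2 + (2 * ε - ε ^ 2) * (1 - ε) ^ 2) * (7 / (10 * ε ^ 2))
        ≤ 7 / (10 * ε ^ 2) - 2.1 := by
      calc _ ≤ (1 - 3 * ε ^ 2) * (7 / (10 * ε ^ 2)) := by gcongr
        _ = _ := by field_simp; ring
    linarith

lemma tl_num (ε : ℝ) (h0 : 0 < ε) (h1 : ε ≤ 1 / 10 ^ 13) :
    Ssum (ENNReal.ofReal ε) (ENNReal.ofReal (1 - ε))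
      (tl (ENNReal.ofReal (6 / 5)) (ENNReal.ofReal (24 / 25)) (ENNReal.ofReal (1 + ε ^ 2 / 4))
        (ENNReal.ofReal (1 - 10000 * ε))) ≤ ENNReal.ofReal (19 / (20 * ε ^ 2)) := by
  have p1 : 0 < 1 - ε := by linarith
  have p4 : 0 < ε ^ 2 := by positivity
  have e2 : ε ^ 2 ≤ 1 / 10 ^ 13 := by nlinarith
  refine (tl_sum _ _ _ _ _ _ ?_ ?_ ?_ ?_).trans ?_
  · rw [ENNReal.ofReal_le_one]; linarith
  · rw [← ENNReal.ofReal_add h0.le p1.le]; simp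
  · simpa using p1
  · simp
  · have p5 : 0 < 1 - 24 / 25 * (1 + ε ^ 2 / 4) := by linarith
    refine (mul_le_mul' le_rfl (add_le_add (HH_num ε h0 h1) (mul_le_mul' (AB_num ε h0 h1) le_rfl))).trans ?_
    rw [← ENNReal.ofReal_mul (by norm_num), one_sub_ofReal (by positivity), one_sub_ofReal (by positivity),
      ← ENNReal.ofReal_inv_of_pos (by norm_num), ← ENNReal.ofReal_inv_of_pos p5,
      ← ENNReal.ofReal_add (by norm_num) (by positivity), ← ENNReal.ofReal_mul (by positivity),
      ← ENNReal.ofReal_add (by positivity) (mul_nonneg (by positivity) (add_nonneg (by norm_num) (by positivity))),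
      ← ENNReal.ofReal_mul (by positivity)]
    apply ENNReal.ofReal_le_ofReal
    have q : (1 - 24 / 25 * (1 + ε ^ 2 / 4))⁻¹ ≤ 26 := by
      rw [inv_le_comm₀ p5 (by norm_num)]; norm_num; linarith
    have q' : (1 - 24 / 25 : ℝ)⁻¹ = 25 := by norm_num
    rw [q']
    calc _ ≤ 6 / 5 * (7 / (10 * ε ^ 2) + 1 / (9000 * ε ^ 2) * (25 + 26)) := by gcongr
      _ = (6 / 5 * (7 / 10 + 51 / 9000)) / ε ^ 2 := by field_simp; norm_num
      _ ≤ (19 / 20) / ε ^ 2 := by gcongr; norm_num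
      _ = _ := by field_simp

lemma TT_num (ε : ℝ) (h0 : 0 < ε) (h1 : ε ≤ 1 / 10 ^ 13) (N : ℕ) :
    Ssum (ENNReal.ofReal ε) (ENNReal.ofReal (1 - ε))
      (TT (tl (ENNReal.ofReal (6 / 5)) (ENNReal.ofReal (24 / 25)) (ENNReal.ofReal (1 + ε ^ 2 / 4))
        (ENNReal.ofReal (1 - 10000 * ε))) N) ≤ ENNReal.ofReal (19 / ε ^ 2) := by
  apply Ssum_TT_le
  have h := tl_num ε h0 h1
  refine (add_le_add h (mul_le_mul' (mul_le_mul' le_rfl h) le_rfl)).trans ?_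
  rw [← ENNReal.ofReal_pow h0.le, ← ENNReal.ofReal_mul (by positivity), 
    ← ENNReal.ofReal_mul (by positivity), ← ENNReal.ofReal_add (by positivity) (by positivity)]
  apply ENNReal.ofReal_le_ofReal
  apply le_of_eq
  field_simp
  norm_num

end numerics

/-! ### Deterministic lower bound on the partition function -/

lemma prod_tl (c r β θ : ENNReal) (l : List (List Bool × List Bool)) :
    (l.map fun p => tl c r β θ p.1 p.2).prod =
      c ^ l.length * r ^ (l.map fun p => df p.1 p.2).sum * β ^ (l.map fun p => zc p.1).sum *
        θ ^ (l.map fun p => gn p.1 p.2).sum := by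
  induction l with
  | nil => simp
  | cons p l ih =>
    simp only [List.map_cons, List.prod_cons, List.sum_cons, List.length_cons]
    rw [ih]
    simp only [tl, pow_add, pow_one]
    ring

lemma Dec.length_le {x y l} (h : Dec x y l) : l.length ≤ x.length + 1 := by
  induction h with
  | last u v => simp
  | cons u v x y l h ih => simp; omega

lemma numOnes_eq {n : ℕ} (x : Fin n → Bool) : numOnes x = oc (List.ofFn x) := by
  rw [← cnt_true, ← card_eq_cnt]; simp [numOnes]

lemma zc_ofFn {n : ℕ} (x : Fin n → Bool) : numOnes x + zc (List.ofFn x) = n := by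
  rw [numOnes_eq]
  simpa [zc, oc] using List.count_true_add_count_false (List.ofFn x)

lemma nPlus_eq {n : ℕ} (x y : Fin n → Bool) : nPlus x y =
    cnt (fun w => lcsLen w (List.ofFn y) = Lcs x y + 1) (List.ofFn x) +
    cnt (fun w => lcsLen (List.ofFn x) w = Lcs x y + 1) (List.ofFn y) := by
  rw [← card_eq_cnt, ← card_eq_cnt]
  unfold nPlus
  congr!

lemma nMinus_eq {n : ℕ} (x y : Fin n → Bool) : nMinus x y =
    cnt (fun w => lcsLen w (List.ofFn y) + 1 = Lcs x y) (List.ofFn x) +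
    cnt (fun w => lcsLen (List.ofFn x) w + 1 = Lcs x y) (List.ofFn y) := by
  rw [← card_eq_cnt, ← card_eq_cnt]
  unfold nMinus
  congr!

lemma nPlus_le {n : ℕ} (x y : Fin n → Bool) : nPlus x y ≤ N1 x y := by
  rw [nPlus_eq, N1, numOnes_eq, numOnes_eq]
  exact add_le_add (cnt_le_oc _ _) (cnt_le_oc _ _)

lemma det_bound {n : ℕ} (x y : Fin n → Bool) (c r β θ : ENNReal) (hc : 1 ≤ c) (hr : r ≤ 1)
    (hθ : θ ≤ 1) :
    ∃ m : ℕ, nMinus x y ≤ 2 * m ∧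
      (c * r ^ 2) ^ m * r ^ df (List.ofFn x) (List.ofFn y) * β ^ zc (List.ofFn x) * θ ^ nPlus x y
        ≤ TT (tl c r β θ) (n + 1) (List.ofFn x) (List.ofFn y) := by
  obtain ⟨l, hl, hv⟩ := exists_dec (List.ofFn x) (List.ofFn y)
  refine ⟨l.length - 1, ?_, ?_⟩
  · have a1 := hl.cntx_le
    have a2 := hl.cnty_le
    rw [nMinus_eq]
    have b1 := cnt_mono (fun w => lcsLen w (List.ofFn y) + 1 = Lcs x y)
      (fun w => lcsLen w (List.ofFn y) < val l) (List.ofFn x) (by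
        intro p s _ h; rw [hv]; unfold Lcs at h; omega)
    have b2 := cnt_mono (fun w => lcsLen (List.ofFn x) w + 1 = Lcs x y)
      (fun w => lcsLen (List.ofFn x) w < val l) (List.ofFn y) (by
        intro p s _ h; rw [hv]; unfold Lcs at h; omega)
    omega
  · have h1 := le_TT (tl c r β θ) hl
    have h2 : l.length ≤ n + 1 := by simpa using hl.length_le
    refine le_trans ?_ (h1.trans (TT_mono' _ _ _ h2))
    rw [prod_tl, hl.zx]
    have g1 : (l.map fun p => gn p.1 p.2).sum ≤ nPlus x y := by
      refine hl.gn_le.trans ?_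
      rw [nPlus_eq]
      refine add_le_add (cnt_mono _ _ _ ?_) (cnt_mono _ _ _ ?_)
      · intro p s hx h
        have := lcs_flip_le p s (List.ofFn y)
        rw [← hx] at this
        rw [hv] at h
        unfold Lcs; omega
      · intro p s hx h
        have := lcs_flip_le p s (List.ofFn x)
        rw [← hx, lcs_comm, lcs_comm (List.ofFn y)] at this
        rw [hv] at h
        unfold Lcs; omega
    have g2 := hl.df_le hv
    have g3 := hl.len_pos
    obtain ⟨m, hm⟩ : ∃ m, l.length = m + 1 := ⟨l.length - 1, by omega⟩
    rw [hm] at g2 ⊢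
    simp only [Nat.add_sub_cancel] at g2 ⊢
    calc _ = c ^ m * r ^ (2 * m + df (List.ofFn x) (List.ofFn y)) * β ^ zc (List.ofFn x) * θ ^ nPlus x y := by
          rw [mul_pow, pow_add, pow_mul]; ring
      _ ≤ _ := by
          refine mul_le_mul' (mul_le_mul' (mul_le_mul' ?_ ?_) le_rfl) ?_
          · exact pow_le_pow_right₀ hc (by omega)
          · exact pow_le_pow_right_of_le_one' hr g2
          · exact pow_le_pow_right_of_le_one' hθ g1

/-! ### Probability -/

lemma wt_W (ε : ℝ) (h0 : 0 ≤ ε) (h1 : ε ≤ 1) {n : ℕ} (x : Fin n → Bool) :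
    ENNReal.ofReal (wt ε x) = W (ENNReal.ofReal ε) (ENNReal.ofReal (1 - ε)) (List.ofFn x) := by
  induction n with
  | zero => simp [wt, W]
  | succ n ih =>
    have e2 : List.ofFn x = x 0 :: List.ofFn (fun i => x (Fin.succ i)) := List.ofFn_succ
    have e3 : wt ε x = (if x 0 then ε else 1 - ε) * wt ε (fun i => x (Fin.succ i)) := by
      simp [wt, Fin.prod_univ_succ]
    rw [e2, e3]
    cases hx : x 0
    · rw [W_false, ← ih]
      simp only [Bool.false_eq_true, if_false]
      rw [ENNReal.ofReal_mul (by linarith)]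
    · rw [W_true, ← ih]
      simp only [if_true]
      rw [ENNReal.ofReal_mul h0]

lemma wt_nonneg (ε : ℝ) (h0 : 0 ≤ ε) (h1 : ε ≤ 1) {n : ℕ} (x : Fin n → Bool) : 0 ≤ wt ε x := by
  refine Finset.prod_nonneg fun i _ => ?_
  split_ifs <;> linarith

lemma pr_markov (ε : ℝ) (h0 : 0 ≤ ε) (h1 : ε ≤ 1) (n : ℕ)
    (E : (Fin n → Bool) → (Fin n → Bool) → Prop) (f : List Bool → List Bool → ENNReal) (A K : ℝ)
    (hA : 0 ≤ A) (hK : 0 ≤ K)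
    (hE : ∀ x y, E x y → ENNReal.ofReal A ≤ f (List.ofFn x) (List.ofFn y))
    (hf : Ssum (ENNReal.ofReal ε) (ENNReal.ofReal (1 - ε)) f ≤ ENNReal.ofReal K) :
    A * pr ε n E ≤ K := by
  rw [← ENNReal.ofReal_le_ofReal_iff hK]
  refine le_trans ?_ hf
  have hinj : Function.Injective (fun p : (Fin n → Bool) × (Fin n → Bool) =>
      (List.ofFn p.1, List.ofFn p.2)) := by
    rintro ⟨x, y⟩ ⟨x', y'⟩ h
    simp only [Prod.mk.injEq] at h
    rw [List.ofFn_injective h.1, List.ofFn_injective h.2]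
  refine le_trans ?_ (ENNReal.tsum_comp_le_tsum_of_injective hinj _)
  rw [tsum_fintype, Fintype.sum_prod_type]
  unfold pr
  rw [Finset.mul_sum]
  rw [ENNReal.ofReal_sum_of_nonneg]
  · refine Finset.sum_le_sum fun x _ => ?_
    rw [Finset.mul_sum, ENNReal.ofReal_sum_of_nonneg]
    · refine Finset.sum_le_sum fun y _ => ?_
      split_ifs with h
      · rw [ENNReal.ofReal_mul hA, ENNReal.ofReal_mul (wt_nonneg ε h0 h1 x), wt_W ε h0 h1, wt_W ε h0 h1, mul_comm]
        gcongr
        exact hE x y h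
      · simp
    · intro y _
      have := wt_nonneg ε h0 h1 x
      have := wt_nonneg ε h0 h1 y
      split_ifs <;> positivity
  · intro x _
    refine mul_nonneg hA (Finset.sum_nonneg fun y _ => ?_)
    have := wt_nonneg ε h0 h1 x
    have := wt_nonneg ε h0 h1 y
    split_ifs <;> positivity

lemma wt_mgf (ε c : ℝ) (n : ℕ) :
    ∑ x : Fin n → Bool, wt ε x * c ^ numOnes x = (ε * c + (1 - ε)) ^ n := by
  have h := Finset.prod_univ_sum (fun _ : Fin n => (Finset.univ : Finset Bool))
    (fun _ b => if b then ε * c else 1 - ε)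
  rw [Fintype.piFinset_univ] at h
  simp at h
  rw [h]
  refine Finset.sum_congr rfl fun x _ => ?_
  rw [wt, numOnes, ← Finset.prod_const, Finset.prod_filter, ← Finset.prod_mul_distrib]
  refine Finset.prod_congr rfl fun i _ => ?_
  split_ifs <;> simp

lemma wt_sum (ε : ℝ) (n : ℕ) : ∑ x : Fin n → Bool, wt ε x = 1 := by
  have := wt_mgf ε 1 n
  simpa using this

lemma chernoff (ε h : ℝ) (h0 : 0 ≤ ε) (h1 : ε ≤ 1 / 2) (hh0 : 0 ≤ h) (hh : h ≤ 1) (n : ℕ) :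
    ∑ x : Fin n → Bool, (if h * n < |(numOnes x : ℝ) - ε * n| then wt ε x else 0)
      ≤ 2 * Real.exp (- (h ^ 2 / 2 * n)) := by
  have key : ∀ s : ℝ, |s| = h → ∑ x : Fin n → Bool, wt ε x * Real.exp (s * ((numOnes x : ℝ) - ε * n)) 
      ≤ Real.exp (h ^ 2 / 2 * n) := by
    intro s hs
    have e1 : ∀ x : Fin n → Bool, wt ε x * Real.exp (s * ((numOnes x : ℝ) - ε * n))
        = Real.exp (- (s * ε * n)) * (wt ε x * (Real.exp s) ^ numOnes x) := by
      intro x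
      rw [← Real.exp_nat_mul]
      rw [show s * ((numOnes x : ℝ) - ε * n) = - (s * ε * n) + numOnes x * s by ring, Real.exp_add]
      ring
    rw [Finset.sum_congr rfl (fun x _ => e1 x), ← Finset.mul_sum, wt_mgf]
    have e2 : ε * Real.exp s + (1 - ε) ≤ Real.exp (ε * s + ε * h ^ 2) := by
      have a1 := Real.abs_exp_sub_one_sub_id_le (x := s) (by rw [hs]; exact hh)
      have a2 := le_of_abs_le a1
      have a3 : s ^ 2 = h ^ 2 := by rw [← sq_abs, hs]
      have a4 := Real.add_one_le_exp (ε * s + ε * h ^ 2)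
      nlinarith
    have e3 : 0 ≤ ε * Real.exp s + (1 - ε) := by
      have := Real.exp_pos s
      have : 0 ≤ 1 - ε := by linarith
      positivity
    calc _ ≤ Real.exp (- (s * ε * n)) * (Real.exp (ε * s + ε * h ^ 2)) ^ n := by gcongr
      _ = Real.exp (ε * h ^ 2 * n) := by
          rw [← Real.exp_nat_mul, ← Real.exp_add]; congr 1; ring
      _ ≤ _ := by
          apply Real.exp_le_exp.2
          have : 0 ≤ h ^ 2 * n := by positivity
          nlinarith
  have k1 := key h (abs_of_nonneg hh0)
  have k2 := key (-h) (by rw [abs_neg, abs_of_nonneg hh0])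
  calc _ ≤ ∑ x : Fin n → Bool, Real.exp (- (h ^ 2 * n)) * 
        (wt ε x * Real.exp (h * ((numOnes x : ℝ) - ε * n)) +
         wt ε x * Real.exp (-h * ((numOnes x : ℝ) - ε * n))) := by
        refine Finset.sum_le_sum fun x _ => ?_
        have hw := wt_nonneg ε h0 (by linarith) x
        split_ifs with hx
        · have : 1 ≤ Real.exp (- (h ^ 2 * n)) * (Real.exp (h * ((numOnes x : ℝ) - ε * n)) +
              Real.exp (-h * ((numOnes x : ℝ) - ε * n))) := by
            rw [mul_add, ← Real.exp_add, ← Real.exp_add]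
            rcases lt_abs.1 hx with h3 | h3
            · have : 1 ≤ Real.exp (-(h ^ 2 * ↑n) + h * (↑(numOnes x) - ε * ↑n)) := by
                apply Real.one_le_exp; nlinarith
              have := Real.exp_pos (-(h ^ 2 * ↑n) + -h * (↑(numOnes x) - ε * ↑n))
              linarith
            · have : 1 ≤ Real.exp (-(h ^ 2 * ↑n) + -h * (↑(numOnes x) - ε * ↑n)) := by
                apply Real.one_le_exp; nlinarith
              have := Real.exp_pos (-(h ^ 2 * ↑n) + h * (↑(numOnes x) - ε * ↑n))
              linarith
          nlinarith
        · positivity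
    _ ≤ Real.exp (- (h ^ 2 * n)) * (Real.exp (h ^ 2 / 2 * n) + Real.exp (h ^ 2 / 2 * n)) := by
        rw [← Finset.mul_sum, Finset.sum_add_distrib]
        gcongr
    _ = _ := by
        rw [← two_mul, mul_left_comm, ← Real.exp_add]; congr 2; ring

lemma final_const (p : ℕ → ℝ) (C c q : ℝ) (hc : 0 < c) (hq : 0 < q) (hq1 : q ≤ 1)
    (h1 : ∀ n : ℕ, 1 - C * Real.exp (-(c * n)) ≤ p n) (h2 : ∀ n : ℕ, q ^ n ≤ p n) :
    ∃ c₁ : ℝ, 0 < c₁ ∧ ∀ n : ℕ, 1 - Real.exp (-c₁ * n) ≤ p n := by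
  obtain ⟨n₁, hn⟩ := exists_nat_ge (max 1 (2 * C / c))
  have hn1 : (1 : ℝ) ≤ n₁ := (le_max_left _ _).trans hn
  have hn2 : 2 * C / c ≤ n₁ := (le_max_right _ _).trans hn
  refine ⟨min (c / 2) (q ^ n₁ / n₁), lt_min (by linarith) (by positivity), fun n => ?_⟩
  rcases le_or_gt n₁ n with h | h
  · refine le_trans ?_ (h1 n)
    have hCn : C ≤ Real.exp (c / 2 * n) := by
      have := Real.add_one_le_exp (c / 2 * n)
      have h3 : (n₁ : ℝ) ≤ n := by exact_mod_cast h
      have h4 : 2 * C ≤ c * n := by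
        rw [div_le_iff₀ hc] at hn2
        nlinarith
      linarith
    have : C * Real.exp (-(c * n)) ≤ Real.exp (-min (c / 2) (q ^ n₁ / n₁) * n) := by
      calc _ ≤ Real.exp (c / 2 * n) * Real.exp (-(c * n)) := by gcongr
        _ = Real.exp (-(c / 2 * n)) := by rw [← Real.exp_add]; congr 1; ring
        _ ≤ _ := by
          apply Real.exp_le_exp.2
          rw [neg_mul]
          gcongr
          exact min_le_left _ _
    linarith
  · refine le_trans ?_ (h2 n)
    have a1 := Real.add_one_le_exp (-min (c / 2) (q ^ n₁ / n₁) * n)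
    have a2 : min (c / 2) (q ^ n₁ / n₁) * n ≤ q ^ n₁ := by
      have h3 : (n : ℝ) ≤ n₁ := by exact_mod_cast h.le
      calc _ ≤ (q ^ n₁ / n₁) * n₁ := by
            gcongr
            exact min_le_right _ _
        _ = _ := by field_simp
    have a3 : q ^ n₁ ≤ q ^ n := pow_le_pow_of_le_one hq.le hq1 h.le
    linarith

/-! ### Conclusion -/

lemma exp_le_of_mul {s t : ℝ} (hs : s < 1) (h : 1 ≤ t * (1 - s)) : Real.exp s ≤ t := by
  have h1 := Real.add_one_le_exp (-s)
  have h2 : Real.exp (-s) * Real.exp s = 1 := by rw [← Real.exp_add]; simp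
  have h3 := Real.exp_pos s
  have h4 : (1 - s) * Real.exp s ≤ 1 := by nlinarith
  have h5 : 0 < 1 - s := by linarith
  by_contra hc
  push Not at hc
  nlinarith

lemma exp_pow_bound (ε : ℝ) (h0 : 0 < ε) (h1 : ε ≤ 1 / 10 ^ 13) (m d z k : ℕ) :
    Real.exp (9 / 100 * m - d / 20 + ε ^ 2 / 5 * z - 20000 * ε * k) ≤
      (6 / 5 * (24 / 25) ^ 2) ^ m * (24 / 25) ^ d * (1 + ε ^ 2 / 4) ^ z * (1 - 10000 * ε) ^ k := by
  have e1 : Real.exp (9 / 100) ≤ 6 / 5 * (24 / 25) ^ 2 := exp_le_of_mul (by norm_num) (by norm_num)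
  have e2 : Real.exp (-(1 / 20)) ≤ 24 / 25 := exp_le_of_mul (by norm_num) (by norm_num)
  have e3 : Real.exp (ε ^ 2 / 5) ≤ 1 + ε ^ 2 / 4 := by
    have : ε ^ 2 ≤ 1 / 100 := by
      have : ε ≤ 1 / 10 := h1.trans (by norm_num)
      nlinarith
    have : 0 < ε ^ 2 := by positivity
    exact exp_le_of_mul (by linarith) (by nlinarith)
  have e4 : Real.exp (-(20000 * ε)) ≤ 1 - 10000 * ε := by
    have : 10000 * ε ≤ 1 / 2 := by
      have : ε ≤ 1 / 20000 := h1.trans (by norm_num)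
      linarith
    exact exp_le_of_mul (by linarith) (by nlinarith)
  have e5 : Real.exp (9 / 100 * m - d / 20 + ε ^ 2 / 5 * z - 20000 * ε * k) =
      Real.exp (9 / 100) ^ m * Real.exp (-(1 / 20)) ^ d * Real.exp (ε ^ 2 / 5) ^ z *
        Real.exp (-(20000 * ε)) ^ k := by
    rw [← Real.exp_nat_mul, ← Real.exp_nat_mul, ← Real.exp_nat_mul, ← Real.exp_nat_mul,
      ← Real.exp_add, ← Real.exp_add, ← Real.exp_add]
    congr 1
    ring
  rw [e5]
  have p1 := Real.exp_pos (9 / 100)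
  have p4 := Real.exp_pos (-(20000 * ε))
  gcongr

/-- The good event. -/
def Good {n : ℕ} (x y : Fin n → Bool) : Prop :=
  1 / 10 ^ 6 * (N1 x y : ℝ) ≤ (nPlus x y : ℝ) ∧ (nMinus x y : ℝ) ≤ 5 / 10 ^ 7 * (N1 x y : ℝ)

/-- The number of ones deviates from its mean. -/
def Dev (ε : ℝ) {n : ℕ} (x : Fin n → Bool) : Prop :=
  ε ^ 2 / 100 * n < |(numOnes x : ℝ) - ε * n|

lemma TT_lower (ε : ℝ) (h0 : 0 < ε) (h1 : ε ≤ 1 / 10 ^ 13) {n : ℕ} (x y : Fin n → Bool)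
    (hE : ¬ Good x y) (hx : ¬ Dev ε x) (hy : ¬ Dev ε y) :
    ENNReal.ofReal (Real.exp (ε ^ 2 / 10 * n)) ≤
      TT (tl (ENNReal.ofReal (6 / 5)) (ENNReal.ofReal (24 / 25)) (ENNReal.ofReal (1 + ε ^ 2 / 4))
        (ENNReal.ofReal (1 - 10000 * ε))) (n + 1) (List.ofFn x) (List.ofFn y) := by
  have hθ : 0 ≤ 1 - 10000 * ε := by
    have : ε ≤ 1 / 20000 := h1.trans (by norm_num)
    linarith
  obtain ⟨m, hm, hb⟩ := det_bound x y (ENNReal.ofReal (6 / 5)) (ENNReal.ofReal (24 / 25))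
    (ENNReal.ofReal (1 + ε ^ 2 / 4)) (ENNReal.ofReal (1 - 10000 * ε))
    (by rw [ENNReal.one_le_ofReal]; norm_num) (by rw [ENNReal.ofReal_le_one]; norm_num)
    (by rw [ENNReal.ofReal_le_one]; linarith)
  refine le_trans ?_ hb
  rw [← ENNReal.ofReal_pow (by norm_num), ← ENNReal.ofReal_mul (by norm_num),
    ← ENNReal.ofReal_pow (by norm_num), ← ENNReal.ofReal_pow (by norm_num),
    ← ENNReal.ofReal_pow (by positivity), ← ENNReal.ofReal_pow hθ,
    ← ENNReal.ofReal_mul (by positivity), ← ENNReal.ofReal_mul (by positivity),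
    ← ENNReal.ofReal_mul (by positivity)]
  apply ENNReal.ofReal_le_ofReal
  refine le_trans ?_ (exp_pow_bound ε h0 h1 m _ _ _)
  apply Real.exp_le_exp.2
  have hp := nPlus_le x y
  have zx := zc_ofFn x
  have zy := zc_ofFn y
  unfold Dev at hx hy
  push Not at hx hy
  rw [abs_le] at hx hy
  obtain ⟨x1, x2⟩ := hx
  obtain ⟨y1, y2⟩ := hy
  have hd : (df (List.ofFn x) (List.ofFn y) : ℝ) ≤ ε ^ 2 / 50 * n := by
    have hdd : (df (List.ofFn x) (List.ofFn y) : ℝ) ≤ |(numOnes x : ℝ) - numOnes y| := by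
      rw [le_abs]
      have : df (List.ofFn x) (List.ofFn y) + numOnes y ≤ numOnes x ∨
          df (List.ofFn x) (List.ofFn y) + numOnes x ≤ numOnes y := by
        unfold df; omega
      rcases this with h | h
      · left
        have : ((df (List.ofFn x) (List.ofFn y) : ℝ) + numOnes y) ≤ numOnes x := by exact_mod_cast h
        linarith
      · right
        have : ((df (List.ofFn x) (List.ofFn y) : ℝ) + numOnes x) ≤ numOnes y := by exact_mod_cast h
        linarith
    refine hdd.trans (abs_le.2 ⟨?_, ?_⟩) <;> linarith
  generalize df (List.ofFn x) (List.ofFn y) = d at *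
  generalize zc (List.ofFn x) = z at *
  have zx' : (numOnes x : ℝ) + z = n := by exact_mod_cast zx
  have hN : (N1 x y : ℝ) = numOnes x + numOnes y := by simp [N1]
  have hp' : (nPlus x y : ℝ) ≤ N1 x y := by exact_mod_cast hp
  have hm' : (nMinus x y : ℝ) ≤ 2 * m := by exact_mod_cast hm
  have hn : (0 : ℝ) ≤ n := by positivity
  have hen : 0 ≤ ε * n := by positivity
  have hen2 : ε ^ 2 * n ≤ 1 / 10 ^ 13 * (ε * n) := by nlinarith
  have hen1 : ε * n ≤ 1 / 10 ^ 13 * n := by nlinarith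
  have hee : 0 ≤ ε ^ 2 * n := by positivity
  have N_up : (N1 x y : ℝ) ≤ 3 * (ε * n) := by rw [hN]; linarith
  have N_lo : ε * n ≤ (N1 x y : ℝ) := by rw [hN]; linarith
  have hz : 9 / 10 * (n : ℝ) ≤ z := by linarith
  have hz' : ε ^ 2 / 5 * (9 / 10 * n) ≤ ε ^ 2 / 5 * z := by gcongr
  have hm0 : (0 : ℝ) ≤ m := by positivity
  unfold Good at hE
  rw [not_and_or, not_le, not_le] at hE
  rcases hE with hE | hE
  · have : ε * (nPlus x y : ℝ) ≤ ε * (1 / 10 ^ 6 * (3 * (ε * n))) := by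
      gcongr; linarith
    nlinarith
  · have : ε * (nPlus x y : ℝ) ≤ ε * (3 * (ε * n)) := by
      gcongr; linarith
    have h3 : ε * (3 * (ε * n)) = 3 * (ε ^ 2 * n) := by ring
    rw [h3] at this
    have : 5 / 10 ^ 7 * (ε * n) ≤ 2 * m := by linarith
    linarith

lemma pr_bad (ε : ℝ) (h0 : 0 < ε) (h1 : ε ≤ 1 / 10 ^ 13) (n : ℕ) :
    pr ε n (fun x y => ¬ Good x y ∧ ¬ Dev ε x ∧ ¬ Dev ε y) ≤
      19 / ε ^ 2 * Real.exp (-(ε ^ 2 / 10 * n)) := by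
  have h := pr_markov ε h0.le (h1.trans (by norm_num)) n
    (fun x y => ¬ Good x y ∧ ¬ Dev ε x ∧ ¬ Dev ε y) _ (Real.exp (ε ^ 2 / 10 * n)) (19 / ε ^ 2)
    (Real.exp_pos _).le (by positivity) (fun x y h => TT_lower ε h0 h1 x y h.1 h.2.1 h.2.2)
    (TT_num ε h0 h1 (n + 1))
  rw [Real.exp_neg, ← div_eq_mul_inv, le_div_iff₀ (Real.exp_pos _), mul_comm]
  exact h

lemma pr_le (ε : ℝ) (h0 : 0 < ε) (h1 : ε ≤ 1 / 10 ^ 13) (n : ℕ) :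
    1 - (19 / ε ^ 2 + 4) * Real.exp (-((ε ^ 2 / 100) ^ 2 / 2 * n)) ≤ pr ε n (fun x y => Good x y) := by
  have hε1 : ε ≤ 1 / 10 := h1.trans (by norm_num)
  have hc := chernoff ε (ε ^ 2 / 100) h0.le (by linarith) (by positivity) (by nlinarith) n
  have hb := pr_bad ε h0 h1 n
  have hb' : 19 / ε ^ 2 * Real.exp (-(ε ^ 2 / 10 * n)) ≤
      19 / ε ^ 2 * Real.exp (-((ε ^ 2 / 100) ^ 2 / 2 * n)) := by
    have h2 : 0 < ε ^ 2 := by positivity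
    have h3 : ε ^ 2 ≤ 1 := by nlinarith
    have h4 : (ε ^ 2 / 100) ^ 2 / 2 ≤ ε ^ 2 / 10 := by nlinarith
    have h5 : (ε ^ 2 / 100) ^ 2 / 2 * n ≤ ε ^ 2 / 10 * n := mul_le_mul_of_nonneg_right h4 (by positivity)
    exact mul_le_mul_of_nonneg_left (Real.exp_le_exp.2 (neg_le_neg h5)) (by positivity)
  set D := ∑ x : Fin n → Bool, (if Dev ε x then wt ε x else 0) with hD
  have hD' : D ≤ 2 * Real.exp (-((ε ^ 2 / 100) ^ 2 / 2 * n)) := by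
    refine le_trans (le_of_eq ?_) hc
    rw [hD]
    refine Finset.sum_congr rfl fun x _ => ?_
    unfold Dev
    congr
  have d1 : ∑ x : Fin n → Bool, ∑ y : Fin n → Bool, (if Dev ε x then wt ε x else 0) * wt ε y = D := by
    simp_rw [← Finset.mul_sum, wt_sum, mul_one]; rfl
  have d2 : ∑ x : Fin n → Bool, ∑ y : Fin n → Bool, wt ε x * (if Dev ε y then wt ε y else 0) = D := by
    rw [← Finset.sum_mul_sum, wt_sum, one_mul]
  have d3 : ∑ x : Fin n → Bool, ∑ y : Fin n → Bool, wt ε x * wt ε y = 1 := by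
    rw [← Finset.sum_mul_sum, wt_sum, one_mul]
  have key : ∑ x : Fin n → Bool, ∑ y : Fin n → Bool, wt ε x * wt ε y ≤
      pr ε n (fun x y => Good x y) + pr ε n (fun x y => ¬ Good x y ∧ ¬ Dev ε x ∧ ¬ Dev ε y)
      + ∑ x : Fin n → Bool, ∑ y : Fin n → Bool, (if Dev ε x then wt ε x else 0) * wt ε y
      + ∑ x : Fin n → Bool, ∑ y : Fin n → Bool, wt ε x * (if Dev ε y then wt ε y else 0) := by
    unfold pr
    rw [← Finset.sum_add_distrib, ← Finset.sum_add_distrib, ← Finset.sum_add_distrib]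
    refine Finset.sum_le_sum fun x _ => ?_
    rw [← Finset.sum_add_distrib, ← Finset.sum_add_distrib, ← Finset.sum_add_distrib]
    refine Finset.sum_le_sum fun y _ => ?_
    have a1 := wt_nonneg ε h0.le (by linarith) x
    have a2 := wt_nonneg ε h0.le (by linarith) y
    have a3 := mul_nonneg a1 a2
    by_cases c1 : Good x y <;> by_cases c2 : Dev ε x <;> by_cases c3 : Dev ε y <;>
      simp [c1, c2, c3] <;> linarith
  rw [d1, d2, d3] at key
  linarith

lemma pr_zero (ε : ℝ) (h0 : 0 < ε) (h1 : ε ≤ 1 / 10 ^ 13) (n : ℕ) :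
    ((1 - ε) ^ 2) ^ n ≤ pr ε n (fun x y => Good x y) := by
  have hε1 : ε ≤ 1 := h1.trans (by norm_num)
  have hg : Good (fun _ : Fin n => false) (fun _ : Fin n => false) := by
    have hN : N1 (fun _ : Fin n => false) (fun _ : Fin n => false) = 0 := by simp [N1, numOnes]
    have hm : nMinus (fun _ : Fin n => false) (fun _ : Fin n => false) = 0 := by simp [nMinus]
    simp [Good, hN, hm]
  have hw : wt ε (fun _ : Fin n => false) = (1 - ε) ^ n := by simp [wt]
  have nn : ∀ x y : Fin n → Bool, 0 ≤ (if Good x y then wt ε x * wt ε y else 0) := by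
    intro x y
    have a1 := wt_nonneg ε h0.le hε1 x
    have a2 := wt_nonneg ε h0.le hε1 y
    split_ifs <;> positivity
  unfold pr
  refine le_trans ?_ (Finset.single_le_sum (fun x _ => Finset.sum_nonneg fun y _ => nn x y)
    (Finset.mem_univ (fun _ : Fin n => false)))
  refine le_trans ?_ (Finset.single_le_sum (fun y _ => nn _ y)
    (Finset.mem_univ (fun _ : Fin n => false)))
  rw [if_pos hg, hw, ← mul_pow, ← pow_two]

/-- There exist constants α₁ > α₂ > 0 and ε₀ > 0 such that for every ε ∈ (0, ε₀] there is a
constant c₁ > 0 (depending on ε but not on n) with: for all n,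
P( n₊(X,Y) ≥ α₁·N₁(X,Y) and n₋(X,Y) ≤ α₂·N₁(X,Y) ) ≥ 1 − e^{−c₁ n}. -/
theorem stmt1 :
    ∃ α₁ α₂ : ℝ, 0 < α₂ ∧ α₂ < α₁ ∧
      ∃ ε₀ : ℝ, 0 < ε₀ ∧ ε₀ ≤ 1 / 2 ∧
        ∀ ε : ℝ, 0 < ε → ε ≤ ε₀ →
          ∃ c₁ : ℝ, 0 < c₁ ∧ ∀ n : ℕ,
            1 - Real.exp (-c₁ * n) ≤
              pr ε n (fun x y =>
                α₁ * (N1 x y : ℝ) ≤ (nPlus x y : ℝ) ∧ (nMinus x y : ℝ) ≤ α₂ * (N1 x y : ℝ)) := by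
  refine ⟨1 / 10 ^ 6, 5 / 10 ^ 7, by norm_num, by norm_num, 1 / 10 ^ 13, by norm_num, by norm_num,
    fun ε h0 h1 => ?_⟩
  have hε1 : ε ≤ 1 / 10 := h1.trans (by norm_num)
  exact final_const (fun n => pr ε n (fun x y => Good x y)) (19 / ε ^ 2 + 4)
    ((ε ^ 2 / 100) ^ 2 / 2) ((1 - ε) ^ 2) (by positivity)
    (by have : 0 < 1 - ε := by linarith
        positivity) (by nlinarith) (pr_le ε h0 h1) (pr_zero ε h0 h1)
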